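/- arXiv:1011.0472 — 2 statements merged into one kernel-verified Lean document; each statement's English description precedes it below -/
import Mathlib

section
/- Consider the sequences produced by Algorithm AGM-EF-∞ (as specified in the context, with each minimizer z_{k+1} of ψ_{k+1} over E assumed to exist). Then for every k ≥ 0, A_k J(x_k) ≤ inf_{x ∈ E} ψ_k(x). -/
noncomputable section

open scoped BigOperators

/-- Bregman divergence induced by `d`. -/
def breg {E : Type*} [NormedAddCommGroup E] [NormedSpace ℝ E]
    (d : E → ℝ) (x y : E) : ℝ :=
  d x - d y - fderiv ℝ d y (x - y)

/-- `d` is `σ`-strongly convex with respect to the norm `‖·‖`. -/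
def StrongConvexOnNorm {E : Type*} [NormedAddCommGroup E] [NormedSpace ℝ E]
    (σ : ℝ) (d : E → ℝ) : Prop :=
  ∀ x y : E, d x ≥ d y + fderiv ℝ d y (x - y) + σ / 2 * ‖x - y‖ ^ 2

/-- `g` is a subgradient of the extended-real-valued function `h` at `y`. -/
def IsSubgradE {E : Type*} [NormedAddCommGroup E] [NormedSpace ℝ E]
    (h : E → EReal) (y : E) (g : E →L[ℝ] ℝ) : Prop :=
  ∀ x, h x ≥ h y + ((g (x - y) : ℝ) : EReal)

/-- `h` is `lam`-strongly convex with respect to `d` (extended-real-valued version). -/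
def ScWrtE {E : Type*} [NormedAddCommGroup E] [NormedSpace ℝ E]
    (d : E → ℝ) (lam : ℝ) (h : E → EReal) : Prop :=
  ∀ y : E, h y ≠ ⊤ → ∀ g : E →L[ℝ] ℝ, IsSubgradE h y g →
    ∀ x, h x ≥ h y + ((g (x - y) + lam * breg d x y : ℝ) : EReal)

/-- `f` is `lam`-strongly convex with respect to `d` (real-valued version). -/
def ScWrtR {E : Type*} [NormedAddCommGroup E] [NormedSpace ℝ E]
    (d : E → ℝ) (lam : ℝ) (f : E → ℝ) : Prop :=
  ∀ y : E, ∀ g : E →L[ℝ] ℝ, (∀ x, f x ≥ f y + g (x - y)) →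
    ∀ x, f x ≥ f y + g (x - y) + lam * breg d x y

/-- Convexity for extended-real-valued functions. -/
def ConvexE {E : Type*} [NormedAddCommGroup E] [NormedSpace ℝ E]
    (h : E → EReal) : Prop :=
  ∀ x y : E, ∀ a b : ℝ, 0 ≤ a → 0 ≤ b → a + b = 1 →
    h (a • x + b • y) ≤ ((a : ℝ) : EReal) * h x + ((b : ℝ) : EReal) * h y

/-- The lower model `ℓ_f(x; y, lam1)`. -/
def ellf {E : Type*} [NormedAddCommGroup E] [NormedSpace ℝ E]
    (d : E → ℝ) (f : E → ℝ) (lam1 : ℝ) (x y : E) : ℝ :=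
  f y + fderiv ℝ f y (x - y) + lam1 * breg d x y


lemma mul_norm_sub_sq_le {F : Type*} [NormedAddCommGroup F] {α β : ℝ} (hα : 0 ≤ α) (hβ : 0 ≤ β) (hαβ : α + β = 1) (x y p : F) :
    α * β * ‖x - y‖ ^ 2 ≤ α * ‖x - p‖ ^ 2 + β * ‖y - p‖ ^ 2 := by
  have h : ‖x - y‖ ≤ ‖x - p‖ + ‖y - p‖ := by
    rw [norm_sub_rev y p]; exact norm_sub_le_norm_sub_add_norm_sub x p y
  have h1 : ‖x - y‖ ^ 2 ≤ (‖x - p‖ + ‖y - p‖) ^ 2 := by gcongr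
  have h2 := mul_le_mul_of_nonneg_left h1 (mul_nonneg hα hβ)
  obtain rfl : β = 1 - α := by linarith
  nlinarith [sq_nonneg (α * ‖x - p‖ - (1 - α) * ‖y - p‖)]

lemma coe_toReal_of_ne {X : Type*} {Ψ : X → EReal} (hbot : ∀ x, Ψ x ≠ ⊥) {w : X} (hw : Ψ w ≠ ⊤) :
    Ψ w = ((Ψ w).toReal : EReal) :=
  (EReal.coe_toReal hw (hbot w)).symm

section FirstOrder

variable {E : Type*} [NormedAddCommGroup E] [NormedSpace ℝ E]

lemma fderiv_apply_le_of_forall_smul {q : E → ℝ} {z v : E} {C : ℝ}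
    (hq : DifferentiableAt ℝ q z)
    (h : ∀ t : ℝ, 0 < t → t ≤ 1 → q (z + t • v) - q z ≤ t * C) :
    fderiv ℝ q z v ≤ C := by
  have hlim := hq.hasFDerivAt.hasLineDerivAt v
  have hlim' := hlim.tendsto_slope_zero_right
  refine le_of_tendsto hlim' ?_
  filter_upwards [Ioc_mem_nhdsGT (zero_lt_one' ℝ)] with t ht
  have h1 := h t ht.1 ht.2
  rw [smul_eq_mul]
  rw [inv_mul_le_iff₀ ht.1]
  exact h1

lemma ConvexOn.add_fderiv_le {f : E → ℝ} (hf : ConvexOn ℝ Set.univ f) {y : E}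
    (hfd : DifferentiableAt ℝ f y) (x : E) : f y + fderiv ℝ f y (x - y) ≤ f x := by
  have h := fderiv_apply_le_of_forall_smul (v := x - y) (C := f x - f y) hfd ?_
  · linarith
  intro t ht ht1
  have h1 := hf.2 (Set.mem_univ y) (Set.mem_univ x) (sub_nonneg.2 ht1) ht.le (by ring)
  have h2 : (1 - t) • y + t • x = y + t • (x - y) := by module
  rw [h2] at h1
  simp only [smul_eq_mul] at h1
  linarith

lemma le_add_fderiv_add_of_lipschitz {f : E → ℝ} {L : ℝ} (hf : Differentiable ℝ f)
    (hL : ∀ x y : E, ‖fderiv ℝ f x - fderiv ℝ f y‖ ≤ L * ‖x - y‖) (x y : E) :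
    f x ≤ f y + fderiv ℝ f y (x - y) + L / 2 * ‖x - y‖ ^ 2 := by
  set v := x - y with hv
  let φ : ℝ → ℝ := fun t => f (y + t • v) - t * fderiv ℝ f y v - L / 2 * ‖v‖ ^ 2 * t ^ 2
  have hφ : ∀ t, HasDerivAt φ
      (fderiv ℝ f (y + t • v) v - fderiv ℝ f y v - L * ‖v‖ ^ 2 * t) t := by
    intro t
    have h1 : HasDerivAt (fun t : ℝ => y + t • v) v t := by
      simpa using ((hasDerivAt_id t).smul_const v).const_add y
    have h2 := (hf (y + t • v)).hasFDerivAt.comp_hasDerivAt t h1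
    have h3 := (hasDerivAt_id t).mul_const (fderiv ℝ f y v)
    have h4 := (hasDerivAt_pow 2 t).const_mul (L / 2 * ‖v‖ ^ 2)
    refine ((h2.sub h3).sub h4).congr_deriv ?_
    simp
    ring
  have hanti : AntitoneOn φ (Set.Icc 0 1) := by
    refine antitoneOn_of_deriv_nonpos (convex_Icc 0 1)
      (fun t _ => (hφ t).continuousAt.continuousWithinAt)
      (fun t _ => (hφ t).differentiableAt.differentiableWithinAt) ?_
    intro t ht
    rw [interior_Icc] at ht
    rw [(hφ t).deriv]
    have h1 := (fderiv ℝ f (y + t • v) - fderiv ℝ f y).le_opNorm v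
    have h2 := hL (y + t • v) y
    rw [add_sub_cancel_left, norm_smul, Real.norm_of_nonneg ht.1.le] at h2
    have h3 := mul_le_mul_of_nonneg_right h2 (norm_nonneg v)
    have h4 := le_abs_self ((fderiv ℝ f (y + t • v) - fderiv ℝ f y) v)
    rw [Real.norm_eq_abs] at h1
    rw [sub_apply] at h1 h4
    nlinarith
  have h := hanti (Set.left_mem_Icc.2 zero_le_one) (Set.right_mem_Icc.2 zero_le_one) zero_le_one
  have hxy : y + (x - y) = x := by abel
  simp only [φ, hv, one_smul, zero_smul, add_zero, hxy] at h
  rw [hv]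
  linarith

/-- First-order optimality for `A • P + s • d + l` on the domain `D` of the convex function `P`. -/
lemma ConvexOn.add_fderiv_le_of_isMin {D : Set E} {P d : E → ℝ} (hP : ConvexOn ℝ D P)
    {A s : ℝ} (hA : 0 < A) (l : E →L[ℝ] ℝ) {z : E} (hz : z ∈ D) (hd : DifferentiableAt ℝ d z)
    (hmin : ∀ w ∈ D, A * P z + s * d z + l z ≤ A * P w + s * d w + l w) :
    ∀ w ∈ D, P z + (-A⁻¹ • (s • fderiv ℝ d z + l)) (w - z) ≤ P w := by
  intro w hw
  have hq : HasFDerivAt (fun y => -(s * d y + l y)) (-(s • fderiv ℝ d z + l)) z :=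
    ((hd.hasFDerivAt.const_mul s).add l.hasFDerivAt).neg
  have h := fderiv_apply_le_of_forall_smul (v := w - z) (C := A * (P w - P z))
    hq.differentiableAt ?_
  · rw [hq.fderiv] at h
    have h1 : (-A⁻¹ • (s • fderiv ℝ d z + l)) (w - z)
        = A⁻¹ * (-(s • fderiv ℝ d z + l)) (w - z) := by
      simp
      ring
    have h2 : A⁻¹ * (-(s • fderiv ℝ d z + l)) (w - z) ≤ P w - P z := by
      rwa [inv_mul_le_iff₀ hA]
    linarith
  intro t ht ht1
  have h1 := hP.2 hz hw (sub_nonneg.2 ht1) ht.le (by ring)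
  have h0 := hP.1 hz hw (sub_nonneg.2 ht1) ht.le (by ring)
  have h2 : (1 - t) • z + t • w = z + t • (w - z) := by module
  rw [h2] at h0 h1
  have h3 := hmin _ h0
  simp only [smul_eq_mul] at h1
  have h4 := mul_le_mul_of_nonneg_left h1 hA.le
  linarith

lemma breg_ge_of_strongConvexOnNorm {σ : ℝ} {d : E → ℝ} (hd : StrongConvexOnNorm σ d) (x y : E) :
    σ / 2 * ‖x - y‖ ^ 2 ≤ breg d x y := by
  have := hd x y
  unfold breg
  linarith

lemma norm_smul_add_three_sq_le {t₁ t₂ t₃ : ℝ} (h₁ : 0 ≤ t₁) (h₂ : 0 ≤ t₂) (h₃ : 0 ≤ t₃)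
    (x y z : E) :
    ‖t₁ • x + t₂ • y + t₃ • z‖ ^ 2
      ≤ (t₁ + t₂ + t₃) * (t₁ * ‖x‖ ^ 2 + t₂ * ‖y‖ ^ 2 + t₃ * ‖z‖ ^ 2) := by
  have h : ‖t₁ • x + t₂ • y + t₃ • z‖ ≤ t₁ * ‖x‖ + t₂ * ‖y‖ + t₃ * ‖z‖ := by
    refine (norm_add₃_le).trans_eq ?_
    simp [norm_smul, abs_of_nonneg, h₁, h₂, h₃]
  have h' : ‖t₁ • x + t₂ • y + t₃ • z‖ ^ 2 ≤ (t₁ * ‖x‖ + t₂ * ‖y‖ + t₃ * ‖z‖) ^ 2 := by gcongr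
  nlinarith [mul_nonneg (mul_nonneg h₁ h₂) (sq_nonneg (‖x‖ - ‖y‖)),
    mul_nonneg (mul_nonneg h₁ h₃) (sq_nonneg (‖x‖ - ‖z‖)),
    mul_nonneg (mul_nonneg h₂ h₃) (sq_nonneg (‖y‖ - ‖z‖))]

end FirstOrder

section ExtendedReal

variable {E : Type*} [NormedAddCommGroup E] [NormedSpace ℝ E]

lemma ConvexE.convexOn_toReal {Ψ : E → EReal} (hconv : ConvexE Ψ) (hbot : ∀ x, Ψ x ≠ ⊥) :
    ConvexOn ℝ {w | Ψ w ≠ ⊤} (fun w => (Ψ w).toReal) := by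
  have key : ∀ x ∈ {w | Ψ w ≠ ⊤}, ∀ y ∈ {w | Ψ w ≠ ⊤}, ∀ a b : ℝ, 0 ≤ a → 0 ≤ b → a + b = 1 →
      Ψ (a • x + b • y) ≤ ((a * (Ψ x).toReal + b * (Ψ y).toReal : ℝ) : EReal) := by
    intro x hx y hy a b ha hb hab
    have h := hconv x y a b ha hb hab
    rw [coe_toReal_of_ne hbot hx, coe_toReal_of_ne hbot hy] at h
    exact_mod_cast h
  have hdom : Convex ℝ {w | Ψ w ≠ ⊤} := fun x hx y hy a b ha hb hab =>
    ((key x hx y hy a b ha hb hab).trans_lt (EReal.coe_lt_top _)).ne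
  refine ⟨hdom, fun x hx y hy a b ha hb hab => ?_⟩
  have h := key x hx y hy a b ha hb hab
  rw [coe_toReal_of_ne hbot (hdom hx hy ha hb hab)] at h
  exact_mod_cast h

lemma ScWrtE.toReal_le {d : E → ℝ} {lam : ℝ} {Ψ : E → EReal} (hsc : ScWrtE d lam Ψ)
    (hbot : ∀ x, Ψ x ≠ ⊥) {y : E} (hy : Ψ y ≠ ⊤) (g : E →L[ℝ] ℝ)
    (hg : ∀ w ∈ {w | Ψ w ≠ ⊤}, (Ψ y).toReal + g (w - y) ≤ (Ψ w).toReal) :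
    ∀ w ∈ {w | Ψ w ≠ ⊤}, (Ψ y).toReal + g (w - y) + lam * breg d w y ≤ (Ψ w).toReal := by
  intro w hw
  have h := hsc y hy g ?_ w
  · rw [coe_toReal_of_ne hbot hy, coe_toReal_of_ne hbot hw] at h
    have h' : (Ψ y).toReal + (g (w - y) + lam * breg d w y) ≤ (Ψ w).toReal := by exact_mod_cast h
    linarith
  intro x
  by_cases hx : Ψ x = ⊤
  · rw [hx]; exact le_top
  · have := hg x hx
    rw [coe_toReal_of_ne hbot hy, coe_toReal_of_ne hbot hx]
    exact_mod_cast this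

/-- Near any point of its domain, a proper lower semicontinuous convex function with an affine
minorant has a Bregman proximal point. -/
lemma exists_isMin_add_breg [FiniteDimensional ℝ E] {σ : ℝ} (hσ : 0 < σ) {d : E → ℝ}
    (hd : Differentiable ℝ d) (hdsc : StrongConvexOnNorm σ d) {Ψ : E → EReal}
    (hbot : ∀ x, Ψ x ≠ ⊥) (hlsc : LowerSemicontinuous Ψ) {m : ℝ} {g : E →L[ℝ] ℝ} {y : E}
    (hy : Ψ y ≠ ⊤) (hg : ∀ w ∈ {w | Ψ w ≠ ⊤}, m + g (w - y) ≤ (Ψ w).toReal)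
    {δ : ℝ} (hδ : 0 < δ) :
    ∃ p, Ψ p ≠ ⊤ ∧ ‖p - y‖ ≤ δ ∧ ∃ n : ℝ, 0 ≤ n ∧ ∀ w ∈ {w | Ψ w ≠ ⊤},
      (Ψ p).toReal + n * breg d p y ≤ (Ψ w).toReal + n * breg d w y := by
  have hmy : m ≤ (Ψ y).toReal := by simpa using hg y hy
  set c := (Ψ y).toReal - m + 1 with hc
  have hcpos : 0 < c := by linarith
  set n := 2 / (σ * δ) * (‖g‖ + c / δ) with hn
  have hn0 : 0 ≤ n := by positivity
  have hnσ : n * (σ / 2) * δ = ‖g‖ + c / δ := by rw [hn]; field_simp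
  have hcont : Continuous fun w => n * breg d w y := by
    unfold breg
    have := hd.continuous
    fun_prop
  have hF : LowerSemicontinuous fun w => Ψ w + ((n * breg d w y : ℝ) : EReal) := by
    refine hlsc.add' (continuous_coe_real_ereal.comp hcont).lowerSemicontinuous fun w => ?_
    exact EReal.continuousAt_add (Or.inr (EReal.coe_ne_bot _)) (Or.inr (EReal.coe_ne_top _))
  have hyb : y ∈ Metric.closedBall y δ := Metric.mem_closedBall_self hδ.le
  obtain ⟨p, hpball, hpmin⟩ := (hF.lowerSemicontinuousOn (Metric.closedBall y δ)).exists_isMinOn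
    ⟨y, hyb⟩ (isCompact_closedBall y δ)
  have hbyy : breg d y y = 0 := by simp [breg]
  have hpy : Ψ p + ((n * breg d p y : ℝ) : EReal) ≤ Ψ y + ((n * breg d y y : ℝ) : EReal) :=
    hpmin hyb
  have hp : Ψ p ≠ ⊤ := by
    intro h
    rw [h, EReal.top_add_coe, coe_toReal_of_ne hbot hy, ← EReal.coe_add] at hpy
    exact EReal.coe_ne_top _ (top_le_iff.1 hpy)
  have hreal : ∀ w, Ψ w ≠ ⊤ → w ∈ Metric.closedBall y δ →
      (Ψ p).toReal + n * breg d p y ≤ (Ψ w).toReal + n * breg d w y := by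
    intro w hw hwb
    have h : Ψ p + ((n * breg d p y : ℝ) : EReal) ≤ Ψ w + ((n * breg d w y : ℝ) : EReal) :=
      hpmin hwb
    rw [coe_toReal_of_ne hbot hp, coe_toReal_of_ne hbot hw] at h
    exact_mod_cast h
  refine ⟨p, hp, by simpa [dist_eq_norm] using hpball, n, hn0, fun w hw => ?_⟩
  by_cases hwb : w ∈ Metric.closedBall y δ
  · exact hreal w hw hwb
  have hr : δ ≤ ‖w - y‖ := by
    rw [Metric.mem_closedBall, dist_eq_norm, not_le] at hwb
    exact hwb.le
  have h1 := hreal y hy hyb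
  rw [hbyy, mul_zero, add_zero] at h1
  refine h1.trans ?_
  have h2 := hg w hw
  have h3 := (abs_le.1 (g.le_opNorm (w - y))).1
  have h4 := mul_le_mul_of_nonneg_left (breg_ge_of_strongConvexOnNorm hdsc w y) hn0
  have h5 : (‖g‖ + c / δ) * ‖w - y‖ ≤ n * (σ / 2 * ‖w - y‖ ^ 2) := by
    rw [← hnσ]
    have : n * (σ / 2) * ‖w - y‖ * δ ≤ n * (σ / 2) * ‖w - y‖ * ‖w - y‖ := by gcongr
    linarith
  have h6 : c ≤ c / δ * ‖w - y‖ := by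
    have : c / δ * δ ≤ c / δ * ‖w - y‖ := by gcongr
    rwa [div_mul_cancel₀ _ hδ.ne'] at this
  linarith

/-- Subgradient strong convexity of a lower semicontinuous convex function yields the convexity
inequality with a quadratic gain, also at points where no subgradient exists. -/
lemma ScWrtE.toReal_combo_le [FiniteDimensional ℝ E] {σ lam : ℝ} (hσ : 0 < σ) (hlam : 0 ≤ lam)
    {d : E → ℝ} (hd : Differentiable ℝ d) (hdsc : StrongConvexOnNorm σ d) {Ψ : E → EReal}
    (hsc : ScWrtE d lam Ψ) (hconv : ConvexE Ψ) (hbot : ∀ x, Ψ x ≠ ⊥)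
    (hlsc : LowerSemicontinuous Ψ) {v : E} {g : E →L[ℝ] ℝ}
    (hg : ∀ w ∈ {w | Ψ w ≠ ⊤}, (Ψ v).toReal + g (w - v) ≤ (Ψ w).toReal)
    {x y : E} (hx : Ψ x ≠ ⊤) (hy : Ψ y ≠ ⊤) {α β : ℝ} (hα : 0 ≤ α) (hβ : 0 ≤ β)
    (hαβ : α + β = 1) :
    (Ψ (α • x + β • y)).toReal + lam * (σ / 2) * (α * β * ‖x - y‖ ^ 2)
      ≤ α * (Ψ x).toReal + β * (Ψ y).toReal := by
  have hP := hconv.convexOn_toReal hbot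
  set b := α • x + β • y with hb
  have hbD : Ψ b ≠ ⊤ := hP.1 hx hy hα hβ hαβ
  have hg' : ∀ w ∈ {w | Ψ w ≠ ⊤}, ((Ψ v).toReal + g (b - v)) + g (w - b) ≤ (Ψ w).toReal := by
    intro w hw
    have h := hg w hw
    have h1 : g (w - v) = g (b - v) + g (w - b) := by rw [← map_add]; congr 1; abel
    linarith
  rw [← le_sub_iff_add_le]
  refine le_of_forall_lt fun c hc => ?_
  have hc' : (c : EReal) < Ψ b := by
    rw [coe_toReal_of_ne hbot hbD]; exact_mod_cast hc
  obtain ⟨ε, hε, hball⟩ := Metric.eventually_nhds_iff.1 (hlsc b c hc')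
  obtain ⟨p, hp, hpb, n, hn, hmin⟩ :=
    exists_isMin_add_breg hσ hd hdsc hbot hlsc hbD hg' (half_pos hε)
  have hcp : c < (Ψ p).toReal := by
    have h : (c : EReal) < Ψ p := hball (y := p) (by rw [dist_eq_norm]; linarith)
    rw [coe_toReal_of_ne hbot hp] at h
    exact_mod_cast h
  have hsub := hP.add_fderiv_le_of_isMin (A := 1) (s := n) one_pos (-(n • fderiv ℝ d b)) hp (hd p)
    (by
      intro w hw
      have h := hmin w hw
      simp only [breg, map_sub] at h
      simp only [neg_apply, smul_apply, smul_eq_mul]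
      linarith)
  set G := -(1 : ℝ)⁻¹ • (n • fderiv ℝ d p + -(n • fderiv ℝ d b)) with hG
  have hsx := hsc.toReal_le hbot hp G hsub x hx
  have hsy := hsc.toReal_le hbot hp G hsub y hy
  have hGb : 0 ≤ G (b - p) := by
    have h1 := hdsc b p
    have h2 := hdsc p b
    have h3 : 0 ≤ σ / 2 * ‖b - p‖ ^ 2 := by positivity
    have h4 : 0 ≤ σ / 2 * ‖p - b‖ ^ 2 := by positivity
    have h5 : fderiv ℝ d b (p - b) = - fderiv ℝ d b (b - p) := by rw [← map_neg]; congr 1; abel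
    have h6 : G (b - p) = n * (fderiv ℝ d b (b - p) - fderiv ℝ d p (b - p)) := by
      simp only [hG, inv_one, add_apply, neg_apply,
        smul_apply, smul_eq_mul]
      ring
    rw [h6]
    exact mul_nonneg hn (by linarith)
  have hGsum : α * G (x - p) + β * G (y - p) = G (b - p) := by
    rw [← smul_eq_mul, ← smul_eq_mul, ← map_smul, ← map_smul, ← map_add]
    congr 1
    rw [hb]
    obtain rfl : β = 1 - α := by linarith
    module
  have hbx := mul_le_mul_of_nonneg_left (breg_ge_of_strongConvexOnNorm hdsc x p) hlam
  have hby := mul_le_mul_of_nonneg_left (breg_ge_of_strongConvexOnNorm hdsc y p) hlam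
  have hn2 := mul_le_mul_of_nonneg_left (mul_norm_sub_sq_le hα hβ hαβ x y p)
    (mul_nonneg hlam (half_pos hσ).le)
  have e1 := mul_le_mul_of_nonneg_left (hsx.trans' (add_le_add_right hbx _)) hα
  have e2 := mul_le_mul_of_nonneg_left (hsy.trans' (add_le_add_right hby _)) hβ
  have e3 : α * (Ψ p).toReal + β * (Ψ p).toReal = (Ψ p).toReal := by rw [← add_mul, hαβ, one_mul]
  nlinarith

end ExtendedReal

section Estimates

variable {E : Type*} [NormedAddCommGroup E] [NormedSpace ℝ E]

/-- The quadratic estimate behind the choice of the extrapolation point `u`. -/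
lemma mul_norm_sub_extrapolation_sq_le {a A t₁ t₂ t₃ K : ℝ} (ha : 0 < a) (hA : 0 ≤ A)
    (h₁ : 0 < t₁) (h₂ : 0 ≤ t₂) (h₃ : 0 ≤ t₃) (hK : 0 ≤ K)
    (hroot : (t₁ + t₂ + t₃) * (A + a) = K * a ^ 2) {x z u z' x' : E}
    (hu : u = ((t₁ + t₂ + t₃) * (A + a) - t₂ * a)⁻¹ •
      ((a * t₁) • z + ((t₁ + t₂ + t₃) * A + t₃ * a) • x))
    (hx' : x' = (A + a)⁻¹ • (A • x + a • z')) :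
    K * (A + a) * ‖x' - u‖ ^ 2
      ≤ t₁ * ‖z' - z‖ ^ 2 + t₂ * ‖z' - u‖ ^ 2 + t₃ * ‖z' - x‖ ^ 2 := by
  set t := t₁ + t₂ + t₃ with ht
  have htpos : 0 < t := by positivity
  have hApos : 0 < A + a := by positivity
  have hden : 0 < t * (A + a) - t₂ * a := by
    have : t * (A + a) - t₂ * a = t₁ * (A + a) + t₂ * A + t₃ * (A + a) := by rw [ht]; ring
    rw [this]; positivity
  have hu' : (t * (A + a) - t₂ * a) • u = (a * t₁) • z + (t * A + t₃ * a) • x := by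
    rw [hu, smul_inv_smul₀ hden.ne']
  have hx'' : (A + a) • x' = A • x + a • z' := by
    rw [hx', smul_inv_smul₀ hApos.ne']
  have hvec : (t * (A + a)) • (x' - u)
      = a • (t₁ • (z' - z) + t₂ • (z' - u) + t₃ • (z' - x)) := by
    have e1 : (t * (A + a)) • (x' - u)
        = t • ((A + a) • x') - (t * (A + a) - t₂ * a) • u - (t₂ * a) • u := by module
    rw [e1, hu', hx'', ht]
    module
  have hnorm := congrArg (fun v => ‖v‖ ^ 2) hvec
  simp only [norm_smul, Real.norm_eq_abs, mul_pow, sq_abs] at hnorm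
  have hJ := norm_smul_add_three_sq_le h₁.le h₂ h₃ (z' - z) (z' - u) (z' - x)
  set N := ‖x' - u‖ ^ 2
  set S := t₁ * ‖z' - z‖ ^ 2 + t₂ * ‖z' - u‖ ^ 2 + t₃ * ‖z' - x‖ ^ 2
  have h1 : t ^ 2 * (A + a) ^ 2 * N ≤ a ^ 2 * (t * S) := by rw [hnorm]; gcongr
  have h2 := mul_le_mul_of_nonneg_left h1 hK
  have h3 : K * (a ^ 2 * (t * S)) = t ^ 2 * (A + a) * S := by
    linear_combination (-(t * S)) * hroot
  have h4 : 0 < t ^ 2 * (A + a) := by positivity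
  refine le_of_mul_le_mul_left ?_ h4
  linarith

/-- A minimizer of `A • Ψ + s • d + l` gives a subgradient of `Ψ` and Bregman growth. -/
lemma exists_subgradient_and_growth {d : E → ℝ} (hd : Differentiable ℝ d) {lam : ℝ}
    {Ψ : E → EReal} (hsc : ScWrtE d lam Ψ) (hconv : ConvexE Ψ) (hbot : ∀ x, Ψ x ≠ ⊥)
    {A s : ℝ} (hA : 0 < A) (l : E →L[ℝ] ℝ) {z : E} (hz : Ψ z ≠ ⊤)
    (hmin : ∀ w ∈ {w | Ψ w ≠ ⊤},
      A * (Ψ z).toReal + s * d z + l z ≤ A * (Ψ w).toReal + s * d w + l w) :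
    (∃ g : E →L[ℝ] ℝ, ∀ w ∈ {w | Ψ w ≠ ⊤}, (Ψ z).toReal + g (w - z) ≤ (Ψ w).toReal) ∧
      ∀ w ∈ {w | Ψ w ≠ ⊤}, A * (Ψ z).toReal + s * d z + l z + (s + A * lam) * breg d w z
        ≤ A * (Ψ w).toReal + s * d w + l w := by
  have hsub := (hconv.convexOn_toReal hbot).add_fderiv_le_of_isMin hA l hz (hd z) hmin
  refine ⟨⟨_, hsub⟩, fun w hw => ?_⟩
  have h := mul_le_mul_of_nonneg_left (hsc.toReal_le hbot hz _ hsub w hw) hA.le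
  have hG : A * (-A⁻¹ • (s • fderiv ℝ d z + l)) (w - z)
      = -(s * fderiv ℝ d z (w - z) + (l w - l z)) := by
    simp only [smul_apply, add_apply, smul_eq_mul, map_sub]
    field_simp
    ring
  have hb : s * breg d w z = s * (d w - d z) - s * fderiv ℝ d z (w - z) := by
    unfold breg; ring
  linarith

/-- Increase of `A • (f + Ψ)` along one accelerated step, in terms of the lower model of `f`. -/
lemma accelerated_step_le [FiniteDimensional ℝ E] {σ lam1 lam2 L : ℝ} (hσ : 0 < σ)
    (hlam1 : 0 ≤ lam1) (hlam2 : 0 ≤ lam2) (hL : σ * lam1 < L) {d : E → ℝ}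
    (hd : Differentiable ℝ d) (hdsc : StrongConvexOnNorm σ d) {Ψ : E → EReal}
    (hbot : ∀ x, Ψ x ≠ ⊥) (hlsc : LowerSemicontinuous Ψ) (hconv : ConvexE Ψ)
    (hsc : ScWrtE d lam2 Ψ) {f : E → ℝ} (hfconv : ConvexOn ℝ Set.univ f)
    (hfdiff : Differentiable ℝ f)
    (hfL : ∀ x y : E, ‖fderiv ℝ f x - fderiv ℝ f y‖ ≤ L * ‖x - y‖)
    {a A : ℝ} (ha : 0 < a) (hA : 0 ≤ A)
    (hroot : (a + A) * (lam1 * a + (lam1 + lam2) * A + 1) + a * lam2 * A = L / σ * a ^ 2)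
    {x z u z' x' : E} (hx : Ψ x ≠ ⊤) (hz' : Ψ z' ≠ ⊤)
    (hg : ∃ g : E →L[ℝ] ℝ, ∀ w ∈ {w | Ψ w ≠ ⊤}, (Ψ z').toReal + g (w - z') ≤ (Ψ w).toReal)
    (hu : u = (((1 + (lam1 + lam2) * A) + lam1 * a + lam2 * a * A / (A + a)) * (A + a)
            - lam1 * a * a)⁻¹ •
          ((a * (1 + (lam1 + lam2) * A)) • z
            + (((1 + (lam1 + lam2) * A) + lam1 * a + lam2 * a * A / (A + a)) * A
                + (lam2 * a * A / (A + a)) * a) • x))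
    (hx' : x' = (A + a)⁻¹ • (A • x + a • z')) :
    (A + a) * (f x' + (Ψ x').toReal) ≤ A * (f x + (Ψ x).toReal)
      + (1 + (lam1 + lam2) * A) * breg d z' z + a * ((Ψ z').toReal + ellf d f lam1 z' u) := by
  obtain ⟨g, hg⟩ := hg
  have hApos : 0 < A + a := by positivity
  have hLpos : 0 ≤ L / σ := div_nonneg ((mul_nonneg hσ.le hlam1).trans hL.le) hσ.le
  have h₁ : 0 < 1 + (lam1 + lam2) * A := by positivity
  have h₂ : 0 ≤ lam1 * a := by positivity
  have h₃ : 0 ≤ lam2 * a * A / (A + a) := by positivity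
  have hquad := mul_norm_sub_extrapolation_sq_le ha hA h₁ h₂ h₃ hLpos
    (by rw [← hroot]; field_simp; ring) hu hx'
  have hΨ : (A + a) * (Ψ x').toReal
      + σ / 2 * (lam2 * a * A / (A + a) * ‖z' - x‖ ^ 2) ≤ A * (Ψ x).toReal + a * (Ψ z').toReal := by
    have h := hsc.toReal_combo_le hσ hlam2 hd hdsc hconv hbot hlsc hg hx hz'
      (α := (A + a)⁻¹ * A) (β := (A + a)⁻¹ * a) (by positivity) (by positivity) (by field_simp)
    rw [mul_smul, mul_smul, ← smul_add, ← hx', norm_sub_rev] at h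
    have h' := mul_le_mul_of_nonneg_left h hApos.le
    have e1 : (A + a) * ((Ψ x').toReal + lam2 * (σ / 2) *
        ((A + a)⁻¹ * A * ((A + a)⁻¹ * a) * ‖z' - x‖ ^ 2)) = (A + a) * (Ψ x').toReal
          + σ / 2 * (lam2 * a * A / (A + a) * ‖z' - x‖ ^ 2) := by field_simp
    have e2 : (A + a) * ((A + a)⁻¹ * A * (Ψ x).toReal + (A + a)⁻¹ * a * (Ψ z').toReal)
        = A * (Ψ x).toReal + a * (Ψ z').toReal := by field_simp
    rwa [e1, e2] at h'
  have hfx : f u + fderiv ℝ f u (x - u) ≤ f x := hfconv.add_fderiv_le (hfdiff u) x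
  have hfx' := le_add_fderiv_add_of_lipschitz hfdiff hfL x' u
  have hlin : (A + a) * fderiv ℝ f u (x' - u)
      = A * fderiv ℝ f u (x - u) + a * fderiv ℝ f u (z' - u) := by
    simp only [← smul_eq_mul, ← map_smul, ← map_add]
    congr 1
    rw [smul_sub, hx', smul_inv_smul₀ hApos.ne']
    module
  have hb1 := mul_le_mul_of_nonneg_left (breg_ge_of_strongConvexOnNorm hdsc z' z) h₁.le
  have hb2 := mul_le_mul_of_nonneg_left (breg_ge_of_strongConvexOnNorm hdsc z' u) h₂
  have hfA := mul_le_mul_of_nonneg_left hfx hA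
  have hfA' := mul_le_mul_of_nonneg_left hfx' hApos.le
  have hq := mul_le_mul_of_nonneg_left hquad (half_pos hσ).le
  have e3 : σ / 2 * (L / σ * (A + a) * ‖x' - u‖ ^ 2) = (A + a) * (L / 2 * ‖x' - u‖ ^ 2) := by
    field_simp
  rw [e3] at hq
  unfold ellf
  linarith

end Estimates

/-- the iterates of AGM-EF-∞ satisfy `A_k J(x_k) ≤ inf ψ_k` for all `k`. -/
theorem stmt6 {E : Type*} [NormedAddCommGroup E] [NormedSpace ℝ E] [FiniteDimensional ℝ E]
    (σ lam1 lam2 L : ℝ) (hσ : 0 < σ) (hlam1 : 0 ≤ lam1) (hlam2 : 0 ≤ lam2)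
    (hL : σ * lam1 < L)
    (d : E → ℝ) (hddiff : Differentiable ℝ d) (hdconv : ConvexOn ℝ Set.univ d)
    (hdsc : StrongConvexOnNorm σ d)
    (Ψ : E → EReal) (hΨbot : ∀ x, Ψ x ≠ ⊥) (hΨprop : ∃ x, Ψ x ≠ ⊤)
    (hΨlsc : LowerSemicontinuous Ψ) (hΨconv : ConvexE Ψ) (hΨsc : ScWrtE d lam2 Ψ)
    (f : E → ℝ) (hfconv : ConvexOn ℝ Set.univ f) (hfdiff : Differentiable ℝ f)
    (hfsc : ScWrtR d lam1 f)
    (hfL : ∀ x y : E, ‖fderiv ℝ f x - fderiv ℝ f y‖ ≤ L * ‖x - y‖)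
    -- Algorithm AGM-EF-∞
    (x z u : ℕ → E) (a A : ℕ → ℝ) (ψ : ℕ → E → EReal)
    (hx0 : Ψ (x 0) ≠ ⊤) (hz0 : z 0 = x 0) (hA0 : A 0 = 0)
    (hψ0 : ∀ w, ψ 0 w = ((breg d w (x 0) : ℝ) : EReal))
    (hapos : ∀ k, 0 < a (k + 1))
    (haroot : ∀ k, (a (k + 1) + A k) * (lam1 * a (k + 1) + (lam1 + lam2) * A k + 1)
        + a (k + 1) * lam2 * A k = L / σ * a (k + 1) ^ 2)
    (hA : ∀ k, A (k + 1) = A k + a (k + 1))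
    (hu : ∀ k,
      u (k + 1) =
        ((((1 + (lam1 + lam2) * A k) + lam1 * a (k + 1)
              + lam2 * a (k + 1) * A k / A (k + 1)) * A (k + 1)
            - lam1 * a (k + 1) * a (k + 1))⁻¹) •
          ((a (k + 1) * (1 + (lam1 + lam2) * A k)) • z k
            + ((((1 + (lam1 + lam2) * A k) + lam1 * a (k + 1)
                  + lam2 * a (k + 1) * A k / A (k + 1)) * A k
                + (lam2 * a (k + 1) * A k / A (k + 1)) * a (k + 1)) • x k)))
    (hψ : ∀ k w, ψ (k + 1) w =
      ψ k w + ((a (k + 1) : ℝ) : EReal) * (Ψ w + ((ellf d f lam1 w (u (k + 1)) : ℝ) : EReal)))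
    (hz : ∀ k w, ψ (k + 1) (z (k + 1)) ≤ ψ (k + 1) w)
    (hx : ∀ k, x (k + 1) = (A (k + 1))⁻¹ • (A k • x k + a (k + 1) • z (k + 1)))
    :
    ∀ k : ℕ, ((A k : ℝ) : EReal) * (((f (x k) : ℝ) : EReal) + Ψ (x k)) ≤ ⨅ w : E, ψ k w := by
  have hAnn : ∀ k, 0 ≤ A k := by
    intro k
    induction k with
    | zero => exact hA0.ge
    | succ k ih => rw [hA]; linarith [hapos k]
  have hApos : ∀ k, 0 < A (k + 1) := fun k => by rw [hA]; linarith [hAnn k, hapos k]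
  have hform : ∀ k, ∃ (l : E →L[ℝ] ℝ) (c : ℝ), ∀ w, ψ k w =
      ((A k : ℝ) : EReal) * Ψ w + (((1 + lam1 * A k) * d w + l w + c : ℝ) : EReal) := by
    intro k
    induction k with
    | zero =>
      refine ⟨-fderiv ℝ d (x 0), fderiv ℝ d (x 0) (x 0) - d (x 0), fun w => ?_⟩
      rw [hψ0, hA0, EReal.coe_zero, zero_mul, zero_add]
      congr 1
      simp only [breg, map_sub, neg_apply]
      ring
    | succ k ih =>
      obtain ⟨l, c, hlc⟩ := ih
      set v := u (k + 1) with hv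
      refine ⟨l + a (k + 1) • (fderiv ℝ f v - lam1 • fderiv ℝ d v),
        c + a (k + 1) * (f v - fderiv ℝ f v v - lam1 * (d v - fderiv ℝ d v v)), fun w => ?_⟩
      rw [hψ, hlc]
      by_cases hw : Ψ w = ⊤
      · rw [hw, EReal.top_add_coe, EReal.coe_mul_top_of_pos (hapos k),
          EReal.coe_mul_top_of_pos (hApos k), EReal.top_add_coe]
        refine EReal.add_top_of_ne_bot ?_
        rcases (hAnn k).eq_or_lt with h0 | h0
        · rw [← h0, EReal.coe_zero, zero_mul, zero_add]
          exact EReal.coe_ne_bot _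
        · rw [EReal.coe_mul_top_of_pos h0, EReal.top_add_coe]
          exact top_ne_bot
      · rw [coe_toReal_of_ne hΨbot hw]
        norm_cast
        rw [hA]
        simp only [ellf, breg, map_sub, add_apply, smul_apply, sub_apply, smul_eq_mul]
        ring
  have hφ : ∀ k w, Ψ w ≠ ⊤ → ψ k w = ((ψ k w).toReal : EReal) := by
    intro k w hw
    obtain ⟨l, c, hlc⟩ := hform k
    rw [hlc, coe_toReal_of_ne hΨbot hw]
    norm_cast
  have hzD : ∀ k, Ψ (z k) ≠ ⊤ := by
    rintro (_ | k) h
    · exact hx0 (hz0 ▸ h)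
    · have hmin := hz k (x 0)
      obtain ⟨l, c, hlc⟩ := hform (k + 1)
      rw [hφ _ _ hx0, hlc, h, EReal.coe_mul_top_of_pos (hApos k), EReal.top_add_coe] at hmin
      exact EReal.coe_ne_top _ (top_le_iff.1 hmin)
  have hxD : ∀ k, Ψ (x k) ≠ ⊤ := by
    intro k
    induction k with
    | zero => exact hx0
    | succ k ih =>
      have h := (hΨconv.convexOn_toReal hΨbot).1 ih (hzD (k + 1))
        (mul_nonneg (inv_nonneg.2 (hAnn (k + 1))) (hAnn k))
        (mul_nonneg (inv_nonneg.2 (hAnn (k + 1))) (hapos k).le)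
        (by rw [← mul_add, ← hA, inv_mul_cancel₀ (hApos k).ne'])
      rw [mul_smul, mul_smul, ← smul_add, ← hx] at h
      exact h
  have hmain : ∀ k, (∃ g : E →L[ℝ] ℝ, ∀ w ∈ {w | Ψ w ≠ ⊤},
        (Ψ (z (k + 1))).toReal + g (w - z (k + 1)) ≤ (Ψ w).toReal) ∧
      ∀ w ∈ {w | Ψ w ≠ ⊤}, (ψ (k + 1) (z (k + 1))).toReal
        + (1 + (lam1 + lam2) * A (k + 1)) * breg d w (z (k + 1)) ≤ (ψ (k + 1) w).toReal := by
    intro k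
    obtain ⟨l, c, hlc⟩ := hform (k + 1)
    have hval : ∀ w ∈ {w | Ψ w ≠ ⊤}, (ψ (k + 1) w).toReal
        = A (k + 1) * (Ψ w).toReal + (1 + lam1 * A (k + 1)) * d w + l w + c := by
      intro w hw
      have h := hlc w
      rw [hφ _ _ hw, coe_toReal_of_ne hΨbot hw] at h
      norm_cast at h
      linarith
    have hgr := exists_subgradient_and_growth hddiff hΨsc hΨconv hΨbot (hApos k)
      (s := 1 + lam1 * A (k + 1)) l (hzD (k + 1)) (by
        intro w hw
        have h := hz k w
        rw [hφ _ _ (hzD (k + 1)), hφ _ _ hw, EReal.coe_le_coe_iff, hval _ (hzD (k + 1)),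
          hval _ hw] at h
        linarith)
    refine ⟨hgr.1, fun w hw => ?_⟩
    have h := hgr.2 w hw
    rw [hval _ (hzD (k + 1)), hval _ hw]
    linarith
  have hgrowth : ∀ k, ∀ w ∈ {w | Ψ w ≠ ⊤}, (ψ k (z k)).toReal
      + (1 + (lam1 + lam2) * A k) * breg d w (z k) ≤ (ψ k w).toReal := by
    rintro (_ | k) w hw
    · rw [hψ0, hψ0, hA0, hz0, EReal.toReal_coe, EReal.toReal_coe]
      simp [breg]
    · exact (hmain k).2 w hw
  have hbound : ∀ k, A k * (f (x k) + (Ψ (x k)).toReal) ≤ (ψ k (z k)).toReal := by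
    intro k
    induction k with
    | zero => rw [hψ0, hA0, hz0]; simp [breg]
    | succ k ih =>
      have hstep := accelerated_step_le hσ hlam1 hlam2 hL hddiff hdsc hΨbot hΨlsc hΨconv hΨsc
        hfconv hfdiff hfL (hapos k) (hAnn k) (haroot k) (hxD k) (hzD (k + 1)) (hmain k).1
        (hA k ▸ hu k) (hA k ▸ hx k)
      have hnext : (ψ (k + 1) (z (k + 1))).toReal = (ψ k (z (k + 1))).toReal + a (k + 1) *
          ((Ψ (z (k + 1))).toReal + ellf d f lam1 (z (k + 1)) (u (k + 1))) := by
        have h := hψ k (z (k + 1))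
        rw [hφ (k + 1) _ (hzD (k + 1)), hφ k _ (hzD (k + 1)),
          coe_toReal_of_ne hΨbot (hzD (k + 1))] at h
        exact_mod_cast h
      have hgk := hgrowth k (z (k + 1)) (hzD (k + 1))
      rw [hnext, hA]
      linarith
  intro k
  refine le_iInf fun w => ?_
  have hzmin : ψ k (z k) ≤ ψ k w := by
    rcases k with _ | k
    · rw [hψ0, hψ0, hz0, EReal.coe_le_coe_iff]
      have h := breg_ge_of_strongConvexOnNorm hdsc w (x 0)
      have h' : 0 ≤ σ / 2 * ‖w - x 0‖ ^ 2 := by positivity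
      have h0 : breg d (x 0) (x 0) = 0 := by simp [breg]
      linarith
    · exact hz k w
  refine le_trans ?_ hzmin
  rw [hφ k _ (hzD k), coe_toReal_of_ne hΨbot (hxD k)]
  exact_mod_cast hbound k
end
end

section
/- Let (a_k) and (c_k) be the step-size sequences of Algorithm AGM-EF-1: c₀ = L' where L' := L/σ + λ2, and for each k ≥ 0, a_{k+1} ∈ (0,1) is the positive root of σ(1−a)(c_k + λ2 a) + σλ1 a = L a², and c_{k+1} = (1 − a_{k+1}) c_k + λ a_{k+1}, with λ = λ1 + λ2 and L > σλ1. Then for every k ≥ 1, ∏_{i=1}^{k} (1 − a_i) ≤ min{ (1 − √(λ/L'))^k, 4L'/(2√(L') + k√(c₀))² }. -/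
/-- If `t = √(1 - a) * s` and `t ≤ a`, then the bound `s ≤ 2 / m` improves to `t ≤ 2 / (m + 1)`. -/
lemma add_one_mul_le_two {s t a m : ℝ} (hs : 0 < s) (ht : 0 ≤ t) (hta : t ≤ a)
    (hts : t ^ 2 = (1 - a) * s ^ 2) (hm : 0 ≤ m) (h : m * s ≤ 2) : (m + 1) * t ≤ 2 := by
  have hle : t ≤ s := by
    refine le_of_sq_le_sq ?_ hs.le
    nlinarith [mul_nonneg (ht.trans hta) (sq_nonneg s)]
  have hgap : t * s / 2 ≤ s - t := by
    have h1 : t * s ^ 2 ≤ (s - t) * (s + t) := by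
      nlinarith [mul_le_mul_of_nonneg_right hta (sq_nonneg s)]
    have h2 : (s - t) * (s + t) ≤ (s - t) * (2 * s) :=
      mul_le_mul_of_nonneg_left (by linarith) (sub_nonneg.2 hle)
    refine le_of_mul_le_mul_right ?_ hs
    nlinarith
  rcases le_or_gt t 2 with ht2 | ht2
  · have h1 : m * t ≤ m * (s * (1 - t / 2)) := mul_le_mul_of_nonneg_left (by linarith) hm
    have h2 : m * s * (1 - t / 2) ≤ 2 * (1 - t / 2) :=
      mul_le_mul_of_nonneg_right h (by linarith)
    linarith
  · nlinarith [mul_pos (sub_pos.2 ht2) hs]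

/-- decay of the product `∏ (1 - a_i)` for the step sizes of AGM-EF-1. -/
theorem stmt14 (σ lam1 lam2 L : ℝ) (hσ : 0 < σ) (hlam1 : 0 ≤ lam1) (hlam2 : 0 ≤ lam2)
    (hL : σ * lam1 < L)
    (a c : ℕ → ℝ) (hc0 : c 0 = L / σ + lam2)
    (hamem : ∀ k : ℕ, a (k + 1) ∈ Set.Ioo (0 : ℝ) 1)
    (haroot : ∀ k : ℕ, σ * (1 - a (k + 1)) * (c k + lam2 * a (k + 1)) + σ * lam1 * a (k + 1)
        = L * a (k + 1) ^ 2)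
    (hc : ∀ k : ℕ, c (k + 1) = (1 - a (k + 1)) * c k + (lam1 + lam2) * a (k + 1)) :
    ∀ k : ℕ, 1 ≤ k →
      (∏ i ∈ Finset.Icc 1 k, (1 - a i)) ≤
        min ((1 - Real.sqrt ((lam1 + lam2) / (L / σ + lam2))) ^ k)
          (4 * (L / σ + lam2) /
            (2 * Real.sqrt (L / σ + lam2) + (k : ℝ) * Real.sqrt (c 0)) ^ 2) := by
  have hLσ : lam1 < L / σ := by rwa [lt_div_iff₀ hσ, mul_comm]
  generalize hℓ : L / σ = ℓ at *
  have hLeq : L = σ * ℓ := by rw [← hℓ]; field_simp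
  subst hLeq
  set M := ℓ + lam2 with hM
  have hMpos : 0 < M := by linarith
  have hpos : ∀ k, 0 < 1 - a (k + 1) := fun k => sub_pos.2 (hamem k).2
  have hcsq : ∀ k, c (k + 1) = M * a (k + 1) ^ 2 := fun k => by
    refine mul_left_cancel₀ hσ.ne' ?_
    rw [hc k, hM]
    linear_combination haroot k
  have hclam : ∀ k, lam1 + lam2 ≤ c k := fun k => by
    induction k with
    | zero => rw [hc0]; linarith
    | succ k ih =>
      rw [hc k]
      nlinarith [mul_le_mul_of_nonneg_left ih (hpos k).le]
  have halow : ∀ k, √((lam1 + lam2) / M) ≤ a (k + 1) := fun k => by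
    refine Real.sqrt_le_iff.2 ⟨(hamem k).1.le, ?_⟩
    rw [div_le_iff₀ hMpos, mul_comm, ← hcsq k]
    exact hclam _
  set P : ℕ → ℝ := fun k => ∏ i ∈ Finset.Icc 1 k, (1 - a i) with hP
  have hP0 : P 0 = 1 := by simp [hP]
  have hPsucc : ∀ k, P (k + 1) = (1 - a (k + 1)) * P k := fun k => by
    simp only [hP]
    rw [Finset.prod_Icc_succ_top (by omega), mul_comm]
  have hPpos : ∀ k, 0 < P k := fun k => by
    induction k with
    | zero => simp [hP0]
    | succ k ih => rw [hPsucc]; exact mul_pos (hpos k) ih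
  have hcP : ∀ k, M * P k ≤ c k := fun k => by
    induction k with
    | zero => rw [hP0, hc0, mul_one]
    | succ k ih =>
      rw [hPsucc, hc k]
      nlinarith [mul_le_mul_of_nonneg_left ih (hpos k).le,
        mul_nonneg (add_nonneg hlam1 hlam2) (hamem k).1.le]
  have hlinear : ∀ k, P k ≤ (1 - √((lam1 + lam2) / M)) ^ k := fun k => by
    induction k with
    | zero => simp [hP0]
    | succ k ih =>
      rw [hPsucc, pow_succ']
      exact mul_le_mul (by linarith [halow k]) ih (hPpos k).le
        (by linarith [halow k, hpos k])
  have hsqrt : ∀ k : ℕ, (2 + (k : ℝ)) * √(P k) ≤ 2 := fun k => by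
    induction k with
    | zero => simp [hP0]
    | succ k ih =>
      push_cast
      rw [← add_assoc]
      refine add_one_mul_le_two (Real.sqrt_pos.2 (hPpos k)) (Real.sqrt_nonneg _) ?_ ?_
        (by positivity) ih (a := a (k + 1))
      · refine Real.sqrt_le_iff.2 ⟨(hamem k).1.le, le_of_mul_le_mul_left ?_ hMpos⟩
        rw [← hcsq k]
        exact hcP _
      · rw [Real.sq_sqrt (hPpos _).le, Real.sq_sqrt (hPpos _).le, hPsucc]
  intro k _
  refine le_min (hlinear k) ?_
  have hden : (2 * √M + (k : ℝ) * √(c 0)) ^ 2 = (2 + (k : ℝ)) ^ 2 * M := by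
    rw [hc0, ← add_mul, mul_pow, Real.sq_sqrt hMpos.le]
  rw [hden, le_div_iff₀ (by positivity)]
  have hsq : (2 + (k : ℝ)) ^ 2 * P k ≤ 4 := by
    have h := pow_le_pow_left₀ (by positivity) (hsqrt k) 2
    rw [mul_pow, Real.sq_sqrt (hPpos k).le] at h
    linarith
  change P k * _ ≤ _
  nlinarith [mul_le_mul_of_nonneg_right hsq hMpos.le]
end
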